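/- The explicit distribution q is the stationary probability distribution of the threshold-policy Markov chain, and the achieved transmission rate equals the stationary mass of the transmit region. Precisely, let M = Σ_{h=0}^∞ Σ_{r=0}^{h} m(h, r), q₀₀ = ( 1 + (1−α)·( Σ_{k=1}^{n₀−1} (1−μ)^{k−1} + (1−μ)^{n₀−1}·M ) )^{−1}, and define q(0,0) = q₀₀, q(k, 0) = (1−α)(1−μ)^{k−1}·q₀₀ for 1 ≤ k < n₀, q(n₀+h, r) = (1−α)(1−μ)^{n₀−1}·m(h, r)·q₀₀ for h ≥ 0 and 0 ≤ r ≤ h, and q = 0 at all other states. Then q is nonnegative, Σ over all states of q equals 1, q is invariant under the chain's transition kernel, and Σ_{δ ≥ n₀, r} q(δ, r) = q₀₀·(1−α)·(1−μ)^{n₀−1}·M. -/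

import Mathlib

/-- m(h, 0): m(0,0) = 1 and
m(h, 0) = Σ_{k=0}^{h−1} γ₂(k)·m(h−k−1, 0)·∏_{j=0}^{k−1} γ₁(j) for h ≥ 1. -/
noncomputable def mZero (γ₁ γ₂ : ℕ → ℝ) : ℕ → ℝ
  | 0 => 1
  | h + 1 =>
      ∑ k ∈ Finset.range (h + 1),
        γ₂ k * mZero γ₁ γ₂ (h - k) * ∏ j ∈ Finset.range k, γ₁ j
  decreasing_by exact Nat.lt_succ_of_le (Nat.sub_le h k)

/-- The weight function m: m(h, r) = m(h−r, 0)·∏_{j=0}^{r−1} γ₁(j) for r ≤ h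
and m(h, r) = 0 for r > h. -/
noncomputable def mWeight (γ₁ γ₂ : ℕ → ℝ) (h r : ℕ) : ℝ :=
  if r ≤ h then mZero γ₁ γ₂ (h - r) * ∏ j ∈ Finset.range r, γ₁ j else 0

/-- The transition kernel of the threshold-n₀ policy Markov chain on ℕ × ℕ:
from (0, r) it moves to (0,0) w.p. α and to (1,0) w.p. 1−α; from (δ, r) with
1 ≤ δ < n₀ (the wait region) it moves to (0,0) w.p. μ and to (δ+1, 0) w.p. 1−μ;
from (δ, r) with δ ≥ n₀ (the transmit region) it moves to (δ+1, r+1) w.p. γ₁(r),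
to (δ+1, 0) w.p. γ₂(r), and to (0,0) w.p. 1 − γ₁(r) − γ₂(r). -/
noncomputable def thresholdKernel (α μ : ℝ) (γ₁ γ₂ : ℕ → ℝ) (n₀ : ℕ)
    (s s' : ℕ × ℕ) : ℝ :=
  if s.1 = 0 then
    (if s' = (0, 0) then α else if s' = (1, 0) then 1 - α else 0)
  else if s.1 < n₀ then
    (if s' = (0, 0) then μ else if s' = (s.1 + 1, 0) then 1 - μ else 0)
  else
    (if s' = (s.1 + 1, s.2 + 1) then γ₁ s.2 else 0)
      + (if s' = (s.1 + 1, 0) then γ₂ s.2 else 0)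
      + (if s' = (0, 0) then 1 - γ₁ s.2 - γ₂ s.2 else 0)

/-- The explicit candidate stationary distribution of the threshold-n₀ chain:
q(0,0) = q₀₀, q(k, 0) = (1−α)(1−μ)^{k−1} q₀₀ for 1 ≤ k < n₀,
q(n₀+h, r) = (1−α)(1−μ)^{n₀−1} m(h, r) q₀₀, and 0 at all other states. -/
noncomputable def thresholdDist (α μ : ℝ) (γ₁ γ₂ : ℕ → ℝ) (n₀ : ℕ) (q00 : ℝ)
    (s : ℕ × ℕ) : ℝ :=
  if s.1 = 0 then (if s.2 = 0 then q00 else 0)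
  else if s.1 < n₀ then
    (if s.2 = 0 then (1 - α) * (1 - μ) ^ (s.1 - 1) * q00 else 0)
  else (1 - α) * (1 - μ) ^ (n₀ - 1) * mWeight γ₁ γ₂ (s.1 - n₀) s.2 * q00

theorem mZero_nonneg {γ₁ γ₂ : ℕ → ℝ} (h₁ : ∀ r, 0 ≤ γ₁ r) (h₂ : ∀ r, 0 ≤ γ₂ r) (h : ℕ) :
    0 ≤ mZero γ₁ γ₂ h := by
  induction h using Nat.strong_induction_on with
  | _ h ih =>
    cases h with
    | zero => simp [mZero]
    | succ h =>
      rw [mZero]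
      refine Finset.sum_nonneg fun k _ => ?_
      exact mul_nonneg (mul_nonneg (h₂ k) (ih _ (Nat.lt_succ_of_le (Nat.sub_le h k))))
        (Finset.prod_nonneg fun j _ => h₁ j)

theorem mWeight_nonneg {γ₁ γ₂ : ℕ → ℝ} (h₁ : ∀ r, 0 ≤ γ₁ r) (h₂ : ∀ r, 0 ≤ γ₂ r) (h r : ℕ) :
    0 ≤ mWeight γ₁ γ₂ h r := by
  unfold mWeight
  split_ifs
  · exact mul_nonneg (mZero_nonneg h₁ h₂ _) (Finset.prod_nonneg fun j _ => h₁ j)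
  · exact le_rfl

theorem mWeight_zero_zero (γ₁ γ₂ : ℕ → ℝ) : mWeight γ₁ γ₂ 0 0 = 1 := by
  simp [mWeight, mZero]

theorem mWeight_of_lt (γ₁ γ₂ : ℕ → ℝ) {h r : ℕ} (hr : h < r) : mWeight γ₁ γ₂ h r = 0 := by
  simp [mWeight, hr]

theorem mWeight_succ_succ (γ₁ γ₂ : ℕ → ℝ) (h r : ℕ) :
    mWeight γ₁ γ₂ (h + 1) (r + 1) = mWeight γ₁ γ₂ h r * γ₁ r := by
  simp only [mWeight, Nat.add_le_add_iff_right, Nat.add_sub_add_right, Finset.prod_range_succ]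
  split_ifs <;> ring

theorem mWeight_succ_zero (γ₁ γ₂ : ℕ → ℝ) (h : ℕ) :
    mWeight γ₁ γ₂ (h + 1) 0 = ∑ k ∈ Finset.range (h + 1), mWeight γ₁ γ₂ h k * γ₂ k := by
  simp only [mWeight, Nat.zero_le, if_true, Nat.sub_zero, Finset.prod_range_zero, mul_one]
  rw [mZero]
  refine Finset.sum_congr rfl fun k hk => ?_
  rw [if_pos (Nat.lt_succ_iff.mp (Finset.mem_range.mp hk))]
  ring

/-- The total weight `∑_{r ≤ h} m(h, r)` of level `h`. -/
noncomputable def levelWeight (γ₁ γ₂ : ℕ → ℝ) (h : ℕ) : ℝ :=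
  ∑ r ∈ Finset.range (h + 1), mWeight γ₁ γ₂ h r

theorem levelWeight_zero (γ₁ γ₂ : ℕ → ℝ) : levelWeight γ₁ γ₂ 0 = 1 := by
  simp [levelWeight, mWeight_zero_zero]

theorem levelWeight_nonneg {γ₁ γ₂ : ℕ → ℝ} (h₁ : ∀ r, 0 ≤ γ₁ r) (h₂ : ∀ r, 0 ≤ γ₂ r) (h : ℕ) :
    0 ≤ levelWeight γ₁ γ₂ h :=
  Finset.sum_nonneg fun r _ => mWeight_nonneg h₁ h₂ h r

theorem levelWeight_succ (γ₁ γ₂ : ℕ → ℝ) (h : ℕ) :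
    levelWeight γ₁ γ₂ (h + 1)
      = ∑ r ∈ Finset.range (h + 1), mWeight γ₁ γ₂ h r * (γ₁ r + γ₂ r) := by
  rw [levelWeight, Finset.sum_range_succ', mWeight_succ_zero, ← Finset.sum_add_distrib]
  refine Finset.sum_congr rfl fun r _ => ?_
  rw [mWeight_succ_succ]
  ring

theorem levelWeight_le_pow {γ₁ γ₂ : ℕ → ℝ} {c : ℝ} (h₁ : ∀ r, 0 ≤ γ₁ r) (h₂ : ∀ r, 0 ≤ γ₂ r)
    (hc : ∀ r, γ₁ r + γ₂ r ≤ c) (h : ℕ) : levelWeight γ₁ γ₂ h ≤ c ^ h := by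
  induction h with
  | zero => simp [levelWeight_zero]
  | succ h ih =>
    have hc0 : 0 ≤ c := (add_nonneg (h₁ 0) (h₂ 0)).trans (hc 0)
    calc levelWeight γ₁ γ₂ (h + 1)
        ≤ ∑ r ∈ Finset.range (h + 1), mWeight γ₁ γ₂ h r * c := by
          rw [levelWeight_succ]
          exact Finset.sum_le_sum fun r _ =>
            mul_le_mul_of_nonneg_left (hc r) (mWeight_nonneg h₁ h₂ h r)
      _ = levelWeight γ₁ γ₂ h * c := by rw [← Finset.sum_mul, levelWeight]
      _ ≤ c ^ h * c := mul_le_mul_of_nonneg_right ih hc0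
      _ = c ^ (h + 1) := (pow_succ c h).symm

theorem summable_levelWeight {γ₁ γ₂ : ℕ → ℝ} {c : ℝ} (h₁ : ∀ r, 0 ≤ γ₁ r) (h₂ : ∀ r, 0 ≤ γ₂ r)
    (hc : ∀ r, γ₁ r + γ₂ r ≤ c) (hc1 : c < 1) : Summable (levelWeight γ₁ γ₂) :=
  Summable.of_nonneg_of_le (levelWeight_nonneg h₁ h₂) (levelWeight_le_pow h₁ h₂ hc)
    (summable_geometric_of_lt_one ((add_nonneg (h₁ 0) (h₂ 0)).trans (hc 0)) hc1)

theorem hasSum_row_mWeight_mul (γ₁ γ₂ g : ℕ → ℝ) (h : ℕ) :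
    HasSum (fun r => mWeight γ₁ γ₂ h r * g r)
      (∑ r ∈ Finset.range (h + 1), mWeight γ₁ γ₂ h r * g r) := by
  refine hasSum_sum_of_ne_finset_zero fun r hr => ?_
  rw [mWeight_of_lt γ₁ γ₂ (by simpa using hr), zero_mul]

/-- The masses `∑_{r ≤ h} m(h, r) (1 - γ₁(r) - γ₂(r))` leaving the levels telescope. -/
theorem hasSum_levelWeight_exit {γ₁ γ₂ : ℕ → ℝ} (hs : Summable (levelWeight γ₁ γ₂)) :
    HasSum (fun h => ∑ r ∈ Finset.range (h + 1), mWeight γ₁ γ₂ h r * (1 - γ₁ r - γ₂ r)) 1 := by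
  have hshift := (hasSum_nat_add_iff' 1).mpr hs.hasSum
  have hdiff := hs.hasSum.sub hshift
  rw [Finset.sum_range_one, levelWeight_zero, sub_sub_cancel] at hdiff
  convert! hdiff using 2 with h
  rw [levelWeight_succ, levelWeight, ← Finset.sum_sub_distrib]
  exact Finset.sum_congr rfl fun r _ => by ring

/-- A nonnegative function on `ℕ × ℕ` is summed row by row, the first rows being split off. -/
theorem hasSum_of_rows {f : ℕ × ℕ → ℝ} {R : ℕ → ℝ} {G : ℝ} (n : ℕ) (hf : ∀ s, 0 ≤ f s)
    (hR : ∀ δ, HasSum (fun r => f (δ, r)) (R δ)) (hG : HasSum (fun h => R (n + 1 + h)) G) :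
    HasSum f (R 0 + ∑ k ∈ Finset.range n, R (k + 1) + G) := by
  have hRsum : HasSum R (R 0 + ∑ k ∈ Finset.range n, R (k + 1) + G) := by
    have := (hasSum_nat_add_iff (f := R) (n + 1)).mp (by simpa only [add_comm] using hG)
    rw [Finset.sum_range_succ'] at this
    rwa [add_comm (R 0), add_comm _ G]
  have hsum : Summable f := by
    refine (summable_prod_of_nonneg hf).mpr ⟨fun δ => (hR δ).summable, ?_⟩
    simpa only [(hR _).tsum_eq] using hRsum.summable
  rw [(hsum.hasSum.prod_fiberwise hR).unique hRsum |>.symm]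
  exact hsum.hasSum

section Dist

variable (α μ : ℝ) (γ₁ γ₂ : ℕ → ℝ) (n : ℕ) (q00 : ℝ)

theorem thresholdDist_zero (r : ℕ) :
    thresholdDist α μ γ₁ γ₂ (n + 1) q00 (0, r) = if r = 0 then q00 else 0 := by
  simp [thresholdDist]

theorem thresholdDist_wait {k : ℕ} (hk : k < n) (r : ℕ) :
    thresholdDist α μ γ₁ γ₂ (n + 1) q00 (k + 1, r)
      = if r = 0 then (1 - α) * (1 - μ) ^ k * q00 else 0 := by
  simp [thresholdDist, hk]

theorem thresholdDist_transmit (h r : ℕ) :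
    thresholdDist α μ γ₁ γ₂ (n + 1) q00 (n + 1 + h, r)
      = (1 - α) * (1 - μ) ^ n * mWeight γ₁ γ₂ h r * q00 := by
  have hn : ¬ n + 1 + h ≤ n := by omega
  simp [thresholdDist, hn]

/-- The sum of the distribution against a nonnegative weight that is `a` at `(0, 0)`, `b` on the
wait region and `g r` on the transmit region. -/
theorem hasSum_thresholdDist_mul {w : ℕ × ℕ → ℝ} {a b G : ℝ} {g : ℕ → ℝ}
    (hq : ∀ s, 0 ≤ thresholdDist α μ γ₁ γ₂ (n + 1) q00 s) (hw : ∀ s, 0 ≤ w s)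
    (hw0 : w (0, 0) = a) (hwait : ∀ k < n, w (k + 1, 0) = b)
    (htrans : ∀ h r, w (n + 1 + h, r) = g r)
    (hG : HasSum (fun h => ∑ r ∈ Finset.range (h + 1), mWeight γ₁ γ₂ h r * g r) G) :
    HasSum (fun s => thresholdDist α μ γ₁ γ₂ (n + 1) q00 s * w s)
      (q00 * (a + (1 - α) * (b * (∑ k ∈ Finset.range n, (1 - μ) ^ k) + (1 - μ) ^ n * G))) := by
  have hrow_trans : ∀ h, HasSum (fun r => thresholdDist α μ γ₁ γ₂ (n + 1) q00 (n + 1 + h, r)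
      * w (n + 1 + h, r)) ((1 - α) * (1 - μ) ^ n * q00
        * ∑ r ∈ Finset.range (h + 1), mWeight γ₁ γ₂ h r * g r) := by
    intro h
    convert! (hasSum_row_mWeight_mul γ₁ γ₂ g h).mul_left ((1 - α) * (1 - μ) ^ n * q00) using 2 with r
    rw [thresholdDist_transmit, htrans]
    ring
  have hrow_zero : HasSum (fun r => thresholdDist α μ γ₁ γ₂ (n + 1) q00 (0, r) * w (0, r))
      (q00 * a) := by
    convert hasSum_single 0 fun r hr => ?_ using 1
    · rw [thresholdDist_zero, if_pos rfl, hw0]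
    · rw [thresholdDist_zero, if_neg hr, zero_mul]
  have hrow_wait : ∀ k < n, HasSum (fun r => thresholdDist α μ γ₁ γ₂ (n + 1) q00 (k + 1, r)
      * w (k + 1, r)) ((1 - α) * (1 - μ) ^ k * q00 * b) := by
    intro k hk
    convert hasSum_single 0 fun r hr => ?_ using 1
    · rw [thresholdDist_wait _ _ _ _ _ _ hk, if_pos rfl, hwait k hk]
    · rw [thresholdDist_wait _ _ _ _ _ _ hk, if_neg hr, zero_mul]
  have hrow : ∀ δ, Summable fun r => thresholdDist α μ γ₁ γ₂ (n + 1) q00 (δ, r) * w (δ, r) := by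
    intro δ
    rcases Nat.lt_or_ge n δ with h | h
    · obtain ⟨k, rfl⟩ := Nat.exists_eq_add_of_lt h
      simpa only [add_right_comm] using (hrow_trans k).summable
    · cases δ with
      | zero => exact hrow_zero.summable
      | succ k => exact (hrow_wait k h).summable
  convert hasSum_of_rows (f := fun s => thresholdDist α μ γ₁ γ₂ (n + 1) q00 s * w s)
    (G := (1 - α) * (1 - μ) ^ n * q00 * G) n
    (fun s => mul_nonneg (hq s) (hw s)) (fun δ => (hrow δ).hasSum) ?_ using 1
  · rw [hrow_zero.tsum_eq, Finset.sum_congr rfl fun k hk =>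
      (hrow_wait k (Finset.mem_range.mp hk)).tsum_eq, ← Finset.sum_mul, ← Finset.sum_mul,
      ← Finset.mul_sum]
    ring
  · simpa only [(hrow_trans _).tsum_eq] using hG.mul_left ((1 - α) * (1 - μ) ^ n * q00)

/-- One step of the chain raises the first coordinate by one or leads to `(0, 0)`. -/
theorem thresholdKernel_of_ne {n₀ : ℕ} {s : ℕ × ℕ} {δ r : ℕ} (hs : s.1 ≠ δ) :
    thresholdKernel α μ γ₁ γ₂ n₀ s (δ + 1, r) = 0 := by
  unfold thresholdKernel
  have : δ ≠ s.1 := hs.symm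
  split_ifs <;> simp_all

theorem thresholdDist_balance_pos (δ r : ℕ) :
    HasSum (fun s => thresholdDist α μ γ₁ γ₂ (n + 1) q00 s
        * thresholdKernel α μ γ₁ γ₂ (n + 1) s (δ + 1, r))
      (thresholdDist α μ γ₁ γ₂ (n + 1) q00 (δ + 1, r)) := by
  set q := thresholdDist α μ γ₁ γ₂ (n + 1) q00 with hq_def
  have key : ∀ m, (∀ k, m < k → q (δ, k) = 0) →
      HasSum (fun s => q s * thresholdKernel α μ γ₁ γ₂ (n + 1) s (δ + 1, r))
        (∑ k ∈ Finset.range (m + 1), q (δ, k)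
          * thresholdKernel α μ γ₁ γ₂ (n + 1) (δ, k) (δ + 1, r)) := by
    intro m hm
    have := hasSum_sum_of_ne_finset_zero (s := {δ} ×ˢ Finset.range (m + 1))
      (f := fun s => q s * thresholdKernel α μ γ₁ γ₂ (n + 1) s (δ + 1, r)) (L := .unconditional _) ?_
    · simpa only [Finset.sum_product, Finset.sum_singleton] using this
    · rintro ⟨a, k⟩ hs
      by_cases ha : a = δ
      · subst ha
        rw [hm k (by simpa using hs), zero_mul]
      · rw [thresholdKernel_of_ne _ _ _ _ ha, mul_zero]
  rcases Nat.lt_or_ge n δ with h | h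
  · obtain ⟨l, rfl⟩ : ∃ l, δ = n + 1 + l := Nat.exists_eq_add_of_le h
    convert key l fun k hk => ?_ using 1
    · have hK : ∀ k, thresholdKernel α μ γ₁ γ₂ (n + 1) (n + 1 + l, k) (n + 1 + l + 1, r)
          = (if r = k + 1 then γ₁ k else 0) + (if r = 0 then γ₂ k else 0) := by
        intro k
        have hn : ¬ n + 1 + l ≤ n := by omega
        simp [thresholdKernel, hn]
      simp only [hK]
      rw [hq_def, add_assoc (n + 1), thresholdDist_transmit]
      simp only [thresholdDist_transmit]
      cases r with
      | zero =>
        rw [mWeight_succ_zero, Finset.mul_sum, Finset.sum_mul]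
        exact Finset.sum_congr rfl fun k _ => by simp; ring
      | succ r =>
        rw [mWeight_succ_succ]
        by_cases hr : r ≤ l
        · rw [Finset.sum_eq_single r]
          · simp; ring
          · intro k _ hk
            simp [Ne.symm hk]
          · intro hr'
            simp at hr'; omega
        · rw [mWeight_of_lt _ _ (not_le.mp hr), Finset.sum_eq_zero]
          · simp
          · intro k hk
            have : r ≠ k := by have := Finset.mem_range.mp hk; omega
            simp [this]
    · rw [hq_def, thresholdDist_transmit, mWeight_of_lt _ _ hk]
      simp
  · convert key 0 fun k hk => ?_ using 1
    · rw [zero_add, Finset.sum_range_one, hq_def]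
      have hnext : thresholdDist α μ γ₁ γ₂ (n + 1) q00 (δ + 1, r)
          = if r = 0 then (1 - α) * (1 - μ) ^ δ * q00 else 0 := by
        rcases h.lt_or_eq with h | rfl
        · exact thresholdDist_wait _ _ _ _ _ _ h r
        · have := thresholdDist_transmit α μ γ₁ γ₂ δ q00 0 r
          rw [add_zero] at this
          rw [this]
          split_ifs with hr
          · rw [hr, mWeight_zero_zero, mul_one]
          · rw [mWeight_of_lt _ _ (Nat.pos_of_ne_zero hr)]
            simp
      rw [hnext]
      cases δ with
      | zero =>
        rw [thresholdDist_zero]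
        by_cases hr : r = 0 <;> simp [thresholdKernel, hr]
        ring
      | succ k =>
        rw [thresholdDist_wait _ _ _ _ _ _ h]
        by_cases hr : r = 0 <;> simp [thresholdKernel, hr, Nat.lt_of_succ_le h]
        ring
    · rw [hq_def]
      cases δ with
      | zero => rw [thresholdDist_zero, if_neg hk.ne']
      | succ l => rw [thresholdDist_wait _ _ _ _ _ _ h, if_neg hk.ne']

end Dist

/-- The explicit distribution q is the stationary probability
distribution of the threshold-policy Markov chain, and the achieved transmission
rate equals the stationary mass of the transmit region:
with M = Σ_{h}Σ_{r≤h} m(h,r) and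
q₀₀ = (1 + (1−α)(Σ_{k=1}^{n₀−1}(1−μ)^{k−1} + (1−μ)^{n₀−1} M))⁻¹,
q is nonnegative, sums to 1, is invariant under the kernel, and
Σ_{δ ≥ n₀, r} q(δ, r) = q₀₀ (1−α)(1−μ)^{n₀−1} M. -/
theorem threshold_stationary_distribution_and_rate
    (α μ : ℝ) (p : ℕ → ℝ) (n₀ : ℕ) (M q00 : ℝ)
    (hμ0 : 0 < μ) (hμα : μ < α) (hα1 : α < 1) (hαμ : α + μ ≤ 1)
    (hp : ∀ r, 0 < p r ∧ p r < 1) (hpmono : Monotone p) (hn₀ : 1 ≤ n₀)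
    (γ₁ γ₂ : ℕ → ℝ)
    (hγ₁ : ∀ r, γ₁ r = α * (1 - p r))
    (hγ₂ : ∀ r, γ₂ r = 1 - α - μ * (1 - p r))
    (hM : M = ∑' h : ℕ, ∑ r ∈ Finset.range (h + 1), mWeight γ₁ γ₂ h r)
    (hq00 : q00 = (1 + (1 - α) * ((∑ k ∈ Finset.range (n₀ - 1), (1 - μ) ^ k)
        + (1 - μ) ^ (n₀ - 1) * M))⁻¹) :
    (∀ s : ℕ × ℕ, 0 ≤ thresholdDist α μ γ₁ γ₂ n₀ q00 s) ∧
    HasSum (thresholdDist α μ γ₁ γ₂ n₀ q00) 1 ∧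
    (∀ s : ℕ × ℕ, thresholdDist α μ γ₁ γ₂ n₀ q00 s
      = ∑' s' : ℕ × ℕ, thresholdDist α μ γ₁ γ₂ n₀ q00 s'
          * thresholdKernel α μ γ₁ γ₂ n₀ s' s) ∧
    (∑' s : ℕ × ℕ, if n₀ ≤ s.1 then thresholdDist α μ γ₁ γ₂ n₀ q00 s else 0)
      = q00 * (1 - α) * (1 - μ) ^ (n₀ - 1) * M := by
  obtain ⟨n, rfl⟩ : ∃ n, n₀ = n + 1 := Nat.exists_eq_add_of_le' hn₀
  rw [Nat.add_sub_cancel] at hq00 ⊢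
  have hα0 : 0 < α := hμ0.trans hμα
  have h₁ : ∀ r, 0 ≤ γ₁ r := fun r => by
    rw [hγ₁]
    exact mul_nonneg hα0.le (by linarith [hp r])
  have h₂ : ∀ r, 0 ≤ γ₂ r := fun r => by
    rw [hγ₂]
    nlinarith [mul_pos hμ0 (hp r).1]
  have hle : ∀ r, γ₁ r + γ₂ r ≤ 1 - μ := fun r => by
    rw [hγ₁, hγ₂]
    nlinarith [mul_pos (sub_pos.mpr hμα) (hp r).1]
  have hs : Summable (levelWeight γ₁ γ₂) := summable_levelWeight h₁ h₂ hle (by linarith)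
  have hMsum : HasSum (fun h => ∑ r ∈ Finset.range (h + 1), mWeight γ₁ γ₂ h r * 1) M := by
    rw [hM]
    simpa only [mul_one] using! hs.hasSum
  have hM0 : 0 ≤ M := by
    rw [hM]
    exact tsum_nonneg (levelWeight_nonneg h₁ h₂)
  have hμ1 : 0 < 1 - μ := by linarith
  have hα1' : 0 < 1 - α := by linarith
  have hD : 0 < 1 + (1 - α) * ((∑ k ∈ Finset.range n, (1 - μ) ^ k) + (1 - μ) ^ n * M) := by
    positivity
  have hq0 : 0 ≤ q00 := by
    rw [hq00]
    exact (inv_pos.mpr hD).le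
  have hq : ∀ s, 0 ≤ thresholdDist α μ γ₁ γ₂ (n + 1) q00 s := by
    intro s
    have := mWeight_nonneg h₁ h₂ (s.1 - (n + 1)) s.2
    unfold thresholdDist
    split_ifs <;> positivity
  have hreset : ∀ r, 0 ≤ 1 - γ₁ r - γ₂ r := fun r => by linarith [hle r]
  refine ⟨hq, ?_, ?_, ?_⟩
  · have := hasSum_thresholdDist_mul α μ γ₁ γ₂ n q00 (w := fun _ => 1) (a := 1) (b := 1)
      (g := fun _ => 1) hq (fun _ => zero_le_one) rfl (fun _ _ => rfl) (fun _ _ => rfl) hMsum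
    simp only [mul_one, one_mul] at this
    convert this using 1
    rw [hq00, inv_mul_cancel₀ hD.ne']
  · rintro ⟨δ, r⟩
    cases δ with
    | succ δ => exact (thresholdDist_balance_pos α μ γ₁ γ₂ n q00 δ r).tsum_eq.symm
    | zero =>
      cases r with
      | succ r =>
        have hK : ∀ s, thresholdKernel α μ γ₁ γ₂ (n + 1) s (0, r + 1) = 0 := fun s => by
          simp [thresholdKernel]
        simp [hK, thresholdDist_zero]
      | zero =>
        have := hasSum_thresholdDist_mul α μ γ₁ γ₂ n q00
          (w := fun s => thresholdKernel α μ γ₁ γ₂ (n + 1) s (0, 0)) (a := α) (b := μ)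
          (g := fun r => 1 - γ₁ r - γ₂ r) hq ?_ ?_ ?_ ?_ (hasSum_levelWeight_exit hs)
        · rw [this.tsum_eq, thresholdDist_zero, if_pos rfl]
          have hgeom := mul_neg_geom_sum (1 - μ) n
          rw [sub_sub_cancel] at hgeom
          rw [hgeom]
          ring
        · intro s
          have := hreset s.2
          simp only [thresholdKernel]
          split_ifs <;> simp_all <;> linarith
        · simp [thresholdKernel]
        · intro k hk
          simp [thresholdKernel, hk]
        · intro h r
          have hn : ¬ n + 1 + h ≤ n := by omega
          simp [thresholdKernel, hn]
  · have := hasSum_thresholdDist_mul α μ γ₁ γ₂ n q00 (w := fun s => if n + 1 ≤ s.1 then 1 else 0)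
      (a := 0) (b := 0) (g := fun _ => 1) hq (fun s => by positivity) (by simp)
      (fun k hk => by simp [hk]) (fun h r => by simp) hMsum
    simp only [mul_ite, mul_one, mul_zero] at this
    rw [this.tsum_eq]
    ring
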